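/- For every integer m ≥ 0 and every n ∈ ℤ, the function ψ_{m,n} is an eigenfunction of the Landau operator Δ_ν with eigenvalue νm: Δ_ν ψ_{m,n} = ν m ψ_{m,n}, where Δ_ν f = −∂²f/(∂z ∂conj(z)) + ν conj(z) ∂f/∂conj(z). -/

import Mathlib

open Complex

/-- The physicists' Hermite polynomials, defined by `H₀ = 1` and
`H_{m+1}(x) = 2x H_m(x) − H_m'(x)`. -/
noncomputable def physHermite : ℕ → Polynomial ℝ
  | 0 => 1
  | m + 1 => 2 * Polynomial.X * physHermite m - Polynomial.derivative (physHermite m)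

/-- `ψ_{m,n}(z) = (2^m m!)^{−1/2} (2ν/π)^{1/4} e^{−(π²/ν)(n+α)²}
e^{(ν/2)z² + 2πi(α+n)z} H_m(√(2ν) y + √(2/ν) π(n+α))`, where `z = x + iy`. -/
noncomputable def psiMN (α ν : ℝ) (m : ℕ) (n : ℤ) (z : ℂ) : ℂ :=
  ((((2 : ℝ) ^ m * Nat.factorial m) ^ (-(1 : ℝ) / 2) *
      (2 * ν / Real.pi) ^ ((1 : ℝ) / 4) *
      Real.exp (-(Real.pi ^ 2 / ν) * (n + α) ^ 2) : ℝ) : ℂ) *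
    Complex.exp (ν / 2 * z ^ 2 + 2 * Real.pi * Complex.I * (α + n) * z) *
    (((physHermite m).eval
        (Real.sqrt (2 * ν) * z.im + Real.sqrt (2 / ν) * Real.pi * (n + α)) : ℝ) : ℂ)

/-- The Wirtinger derivative `∂f/∂z = (1/2)(∂f/∂x − i ∂f/∂y)`, expressed via the real
Fréchet derivative. -/
noncomputable def wirtingerZ (f : ℂ → ℂ) (z : ℂ) : ℂ :=
  (1 / 2 : ℂ) * (fderiv ℝ f z 1 - Complex.I * fderiv ℝ f z Complex.I)

/-- The conjugate Wirtinger derivative `∂f/∂conj(z) = (1/2)(∂f/∂x + i ∂f/∂y)`. -/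
noncomputable def wirtingerZbar (f : ℂ → ℂ) (z : ℂ) : ℂ :=
  (1 / 2 : ℂ) * (fderiv ℝ f z 1 + Complex.I * fderiv ℝ f z Complex.I)

open Polynomial in
/-- The derivative lowers the index of a Hermite polynomial: `H_{m+1}' = 2(m+1) H_m`. -/
theorem derivative_physHermite_succ (m : ℕ) :
    derivative (physHermite (m + 1)) = 2 * ((m : ℝ[X]) + 1) * physHermite m := by
  induction m with
  | zero => simp [physHermite]
  | succ m ih =>
    have h : physHermite (m + 1) = 2 * X * physHermite m - derivative (physHermite m) := rfl
    have h' : derivative (physHermite (m + 1 + 1)) = 2 * physHermite (m + 1)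
        + 2 * X * derivative (physHermite (m + 1))
        - derivative (derivative (physHermite (m + 1))) := by
      rw [physHermite]
      simp [derivative_mul]
    have h'' : derivative (2 * ((m : ℝ[X]) + 1) * physHermite m)
        = 2 * ((m : ℝ[X]) + 1) * derivative (physHermite m) := by
      simp [derivative_mul]
    rw [h', ih, h'']
    push_cast
    linear_combination (-(2 * ((m : ℝ[X]) + 1))) * h

open Polynomial in
/-- Hermite's differential equation `2x H_m' − H_m'' = 2m H_m`. -/
theorem physHermite_differential_equation (m : ℕ) :
    2 * X * derivative (physHermite m) - derivative (derivative (physHermite m))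
      = 2 * (m : ℝ[X]) * physHermite m := by
  have h := derivative_physHermite_succ m
  rw [physHermite] at h
  simp only [derivative_sub, derivative_mul, derivative_X, derivative_ofNat] at h
  linear_combination h

/-- A polynomial in `Im z` times the exponential of a quadratic polynomial in `z`. -/
noncomputable def expQuadPoly (K A B : ℂ) (a b : ℝ) (P : Polynomial ℝ) (z : ℂ) : ℂ :=
  K * Complex.exp (A * z ^ 2 + B * z) * ((P.eval (a * z.im + b) : ℝ) : ℂ)

theorem fderiv_expQuadPoly (K A B : ℂ) (a b : ℝ) (P : Polynomial ℝ) (z v : ℂ) :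
    fderiv ℝ (expQuadPoly K A B a b P) z v
      = K * Complex.exp (A * z ^ 2 + B * z) *
        ((2 * A * z + B) * v * ((P.eval (a * z.im + b) : ℝ) : ℂ)
          + a * v.im * ((P.derivative.eval (a * z.im + b) : ℝ) : ℂ)) := by
  have hexp : HasDerivAt (fun w : ℂ => K * Complex.exp (A * w ^ 2 + B * w))
      (K * (Complex.exp (A * z ^ 2 + B * z) * (2 * A * z + B))) z := by
    have hquad : HasDerivAt (fun w : ℂ => A * w ^ 2 + B * w) (2 * A * z + B) z := by
      refine (((hasDerivAt_pow 2 z).const_mul A).add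
        ((hasDerivAt_id z).const_mul B)).congr_deriv ?_
      simp
      ring
    exact hquad.cexp.const_mul K
  have harg : HasFDerivAt (fun w : ℂ => a * w.im + b) (a • Complex.imCLM) z :=
    (Complex.imCLM.hasFDerivAt.const_mul a).add_const b
  have hpoly := Complex.ofRealCLM.hasFDerivAt.comp z
    ((P.hasDerivAt (a * z.im + b)).comp_hasFDerivAt z harg)
  have hprod := (hexp.hasFDerivAt.restrictScalars ℝ).mul hpoly
  have hfun : expQuadPoly K A B a b P = (fun w : ℂ => K * Complex.exp (A * w ^ 2 + B * w)) *
      (Complex.ofRealCLM ∘ (fun x => P.eval x) ∘ fun w : ℂ => a * w.im + b) := rfl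
  rw [hfun, hprod.fderiv]
  simp
  ring

theorem wirtingerZ_expQuadPoly (K A B : ℂ) (a b : ℝ) (P : Polynomial ℝ) (z : ℂ) :
    wirtingerZ (expQuadPoly K A B a b P) z
      = (2 * A * z + B) * expQuadPoly K A B a b P z
        - Complex.I * a / 2 * expQuadPoly K A B a b P.derivative z := by
  simp only [wirtingerZ, fderiv_expQuadPoly, expQuadPoly, Complex.one_im, Complex.I_im,
    Complex.ofReal_zero, Complex.ofReal_one]
  linear_combination (-(1 / 2) * K * Complex.exp (A * z ^ 2 + B * z) * (2 * A * z + B) *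
    ((P.eval (a * z.im + b) : ℝ) : ℂ)) * Complex.I_mul_I

theorem wirtingerZbar_expQuadPoly (K A B : ℂ) (a b : ℝ) (P : Polynomial ℝ) (z : ℂ) :
    wirtingerZbar (expQuadPoly K A B a b P) z
      = expQuadPoly (Complex.I * a / 2 * K) A B a b P.derivative z := by
  simp only [wirtingerZbar, fderiv_expQuadPoly, expQuadPoly, Complex.one_im, Complex.I_im,
    Complex.ofReal_zero, Complex.ofReal_one]
  linear_combination ((1 / 2) * K * Complex.exp (A * z ^ 2 + B * z) * (2 * A * z + B) *
    ((P.eval (a * z.im + b) : ℝ) : ℂ)) * Complex.I_mul_I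

/-- The Landau operator on functions of the form `expQuadPoly`. -/
theorem landau_expQuadPoly (ν c : ℝ) (hν : 0 < ν) (K : ℂ) (P : Polynomial ℝ) (μ : ℝ)
    (hP : 2 * Polynomial.X * P.derivative - P.derivative.derivative
      = 2 * Polynomial.C μ * P) (z : ℂ) :
    let f := expQuadPoly K (ν / 2) (2 * Real.pi * Complex.I * c) (√(2 * ν))
      (√(2 / ν) * Real.pi * c) P;
    -(wirtingerZ (fun w : ℂ => wirtingerZbar f w) z)
        + ν * (starRingEnd ℂ) z * wirtingerZbar f z = ν * μ * f z := by
  intro f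
  have hf : (fun w : ℂ => wirtingerZbar f w) = _ :=
    funext (wirtingerZbar_expQuadPoly K _ _ _ _ P)
  rw [hf, wirtingerZ_expQuadPoly, wirtingerZbar_expQuadPoly]
  simp only [f, expQuadPoly]
  have hsqrt : √(2 * ν) ^ 2 = 2 * ν := Real.sq_sqrt (by positivity)
  have hsqrt' : ν * √(2 / ν) = √(2 * ν) := by
    rw [← Real.sqrt_sq hν.le, ← Real.sqrt_mul (by positivity), Real.sqrt_sq hν.le]
    congr 1
    field_simp
  generalize √(2 * ν) = a at *
  generalize √(2 / ν) = s at *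
  have hode := congrArg (Polynomial.eval (a * z.im + s * Real.pi * c)) hP
  simp only [Polynomial.eval_sub, Polynomial.eval_mul, Polynomial.eval_X, Polynomial.eval_C,
    Polynomial.eval_ofNat] at hode
  generalize Polynomial.eval (a * z.im + s * Real.pi * c) P = p at *
  generalize Polynomial.eval (a * z.im + s * Real.pi * c) P.derivative = q at *
  generalize Polynomial.eval (a * z.im + s * Real.pi * c) P.derivative.derivative = r at *
  generalize Complex.exp _ = E
  have hode' : (2 * (a * z.im + s * Real.pi * c) * q - r : ℂ) = 2 * μ * p := by
    exact_mod_cast hode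
  have ha : (a : ℂ) ^ 2 = 2 * ν := by exact_mod_cast hsqrt
  have hs : (ν * s : ℂ) = a := by exact_mod_cast hsqrt'
  have hconj : (starRingEnd ℂ) z = z - 2 * z.im * Complex.I := by
    apply Complex.ext <;> simp
    ring
  rw [hconj]
  linear_combination (K * E * ν / 2) * hode' - (K * E * r / 4) * ha
    - (K * E * Real.pi * c * q) * hs
    + (K * E * (a ^ 2 * r / 4 - (ν * z.im + Real.pi * c) * a * q)) * Complex.I_sq

/-- Each `ψ_{m,n}` is an eigenfunction of the Landau operator
`Δ_ν f = −∂²f/(∂z ∂conj(z)) + ν conj(z) ∂f/∂conj(z)` with eigenvalue `νm`. -/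
theorem stmt_19 (α ν : ℝ) (hν : 0 < ν) (m : ℕ) (n : ℤ) :
    ∀ z : ℂ,
      -(wirtingerZ (fun w : ℂ => wirtingerZbar (psiMN α ν m n) w) z)
          + ν * (starRingEnd ℂ) z * wirtingerZbar (psiMN α ν m n) z
        = ν * m * psiMN α ν m n z := by
  intro z
  have hpsi : psiMN α ν m n = expQuadPoly
      (((2 : ℝ) ^ m * Nat.factorial m) ^ (-(1 : ℝ) / 2) * (2 * ν / Real.pi) ^ ((1 : ℝ) / 4) *
        Real.exp (-(Real.pi ^ 2 / ν) * (n + α) ^ 2) : ℝ)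
      (ν / 2) (2 * Real.pi * Complex.I * ((n + α : ℝ) : ℂ)) (√(2 * ν))
      (√(2 / ν) * Real.pi * (n + α)) (physHermite m) := by
    funext w
    simp only [psiMN, expQuadPoly, Complex.ofReal_add, Complex.ofReal_intCast,
      add_comm (α : ℂ)]
  rw [hpsi]
  exact_mod_cast landau_expQuadPoly ν (n + α) hν _ (physHermite m) m
    (by simpa using physHermite_differential_equation m) z
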